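/- arXiv:2006.12276 — 4 statements merged into one kernel-verified Lean document; each statement's English description precedes it below -/
import Mathlib

section
/- Suppose init j ≥ 0 for every j : Fin n and every transfer in the list L has amount v t ≥ 0. If L is balance-respecting, then no account ever becomes negative: for every prefix P of L and every j : Fin n, acc(j, P) ≥ 0. In particular no process ever spends money it does not have (no double spending). -/
/-- A money transfer: sender `s`, receiver `r`, amount `v`. -/
structure Transfer (n : ℕ) where
  s : Fin n
  r : Fin n
  v : ℤ

/-- Total money transferred to `j` in `L`. -/
def plus {n : ℕ} (j : Fin n) (L : List (Transfer n)) : ℤ :=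
  ((L.filter (fun t => decide (t.r = j))).map (fun t => t.v)).sum

/-- Total money transferred from `j` in `L`. -/
def minus {n : ℕ} (j : Fin n) (L : List (Transfer n)) : ℤ :=
  ((L.filter (fun t => decide (t.s = j))).map (fun t => t.v)).sum

/-- The value of `j`'s account after the transfers of `L`. -/
def acc {n : ℕ} (init : Fin n → ℤ) (j : Fin n) (L : List (Transfer n)) : ℤ :=
  init j + plus j L - minus j L

/-- A list of transfers is balance-respecting if each transfer spends only
money its sender has at that point. -/
def BalanceRespecting {n : ℕ} (init : Fin n → ℤ) (L : List (Transfer n)) : Prop :=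
  ∀ (P : List (Transfer n)) (t : Transfer n) (Q : List (Transfer n)),
    L = P ++ t :: Q → t.v ≤ acc init t.s P

theorem acc_append_singleton {n : ℕ} (init : Fin n → ℤ) (j : Fin n)
    (P : List (Transfer n)) (t : Transfer n) :
    acc init j (P ++ [t]) =
      acc init j P + (if t.r = j then t.v else 0) - (if t.s = j then t.v else 0) := by
  by_cases hr : t.r = j <;> by_cases hs : t.s = j <;>
    simp [acc, plus, minus, List.filter_append, hr, hs] <;> ring

/-- with nonnegative initial balances and nonnegative amounts,
a balance-respecting list never drives any account negative. -/
theorem acc_nonneg_of_balanceRespecting (n : ℕ) (init : Fin n → ℤ)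
    (hinit : ∀ j, 0 ≤ init j) (L : List (Transfer n))
    (hv : ∀ t ∈ L, 0 ≤ t.v) (hbr : BalanceRespecting init L) :
    ∀ P : List (Transfer n), P <+: L → ∀ j : Fin n, 0 ≤ acc init j P := by
  intro P
  induction P using List.reverseRecOn with
  | nil => simpa [acc, plus, minus] using hinit
  | append_singleton P t ih =>
    rintro ⟨Q, rfl⟩ j
    have hacc := ih ⟨t :: Q, by simp⟩ j
    have ht : 0 ≤ t.v := hv t (by simp)
    have hspend : t.v ≤ acc init t.s P := hbr P t Q (by simp)
    rw [acc_append_singleton]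
    by_cases hs : t.s = j
    · subst hs
      split_ifs <;> omega
    · split_ifs <;> omega
end

section
/- Fix a process ℓ : Fin n, and let L and L' be lists of transfers all of whose amounts are nonnegative. If the multiset of entries of L' with sender ℓ equals the multiset of entries of L with sender ℓ, and the multiset of entries of L' with receiver ℓ contains (as a multiset) the multiset of entries of L with receiver ℓ, then acc(ℓ, L') ≥ acc(ℓ, L). -/
/-- Summing a function that is nonnegative on `M'` is monotone in sub-multisets of `M'`. -/
theorem Multiset.sum_map_le_sum_map_of_le {α : Type*} (f : α → ℤ) {M M' : Multiset α}
    (hle : M ≤ M') (hf : ∀ a ∈ M', 0 ≤ f a) : (M.map f).sum ≤ (M'.map f).sum := by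
  obtain ⟨N, rfl⟩ := Multiset.le_iff_exists_add.mp hle
  rw [Multiset.map_add, Multiset.sum_add]
  refine le_add_of_nonneg_right (Multiset.sum_nonneg fun x hx => ?_)
  obtain ⟨a, ha, rfl⟩ := Multiset.mem_map.mp hx
  exact hf a (Multiset.mem_add.mpr (Or.inr ha))

theorem minus_congr {n : ℕ} {j : Fin n} {L L' : List (Transfer n)}
    (h : (↑(L'.filter (fun t => decide (t.s = j))) : Multiset (Transfer n)) =
      ↑(L.filter (fun t => decide (t.s = j)))) : minus j L' = minus j L :=
  ((Multiset.coe_eq_coe.mp h).map _).sum_eq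

theorem plus_le_plus {n : ℕ} {j : Fin n} {L L' : List (Transfer n)}
    (hL' : ∀ t ∈ L', 0 ≤ t.v)
    (h : (↑(L.filter (fun t => decide (t.r = j))) : Multiset (Transfer n)) ≤
      ↑(L'.filter (fun t => decide (t.r = j)))) : plus j L ≤ plus j L' := by
  simpa only [plus, Multiset.map_coe, Multiset.sum_coe] using
    Multiset.sum_map_le_sum_map_of_le (fun t => t.v) h
      fun t ht => hL' t (List.mem_of_mem_filter (Multiset.mem_coe.mp ht))

/-- if `L'` contains the same outgoing transfers of `ℓ` as `L`
(as multisets) and at least the incoming transfers of `ℓ` of `L`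
(as multisets), and all amounts are nonnegative, then `ℓ`'s account in `L'`
is at least its account in `L`. -/
theorem acc_le_of_multiset_le (n : ℕ) (init : Fin n → ℤ) (ℓ : Fin n)
    (L L' : List (Transfer n))
    (hL : ∀ t ∈ L, 0 ≤ t.v) (hL' : ∀ t ∈ L', 0 ≤ t.v)
    (hsend : (↑(L'.filter (fun t => decide (t.s = ℓ))) : Multiset (Transfer n)) =
      ↑(L.filter (fun t => decide (t.s = ℓ))))
    (hrecv : (↑(L.filter (fun t => decide (t.r = ℓ))) : Multiset (Transfer n)) ≤
      ↑(L'.filter (fun t => decide (t.r = ℓ)))) :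
    acc init ℓ L ≤ acc init ℓ L' := by
  have hplus := plus_le_plus hL' hrecv
  have hminus := minus_congr hsend
  unfold acc
  linarith
end

section
/- Assume init j ≥ 0 for every j and every amount occurring in every list T p is nonnegative. Let S be a valid processing sequence in which the event e = (p, m) occurs at position z, and let M be the set of events occurring at positions earlier than z in S. Let S' be a valid processing sequence such that e does not occur in S', every event of M occurs in S', and the events of S' with first component p are exactly the events (p, m') with m' < m. Then S' ++ [e] is a valid processing sequence. -/
/-- The transfer induced by the event `(p, m)`: sender `p`, receiver and
amount given by the `m`-th transfer issued by `p` (i.e. the `m`-th entry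
of `T p`). -/
def inducedTransfer {n : ℕ} (T : Fin n → List (Fin n × ℤ)) (e : Fin n × ℕ) :
    Transfer n :=
  { s := e.1
    r := ((T e.1).getD e.2 (e.1, 0)).1
    v := ((T e.1).getD e.2 (e.1, 0)).2 }

/-- The induced transfer list of a processing sequence. -/
def inducedList {n : ℕ} (T : Fin n → List (Fin n × ℤ))
    (S : List (Fin n × ℕ)) : List (Transfer n) :=
  S.map (inducedTransfer T)

/-- `S` is a processing sequence: a duplicate-free list of events,
where an event is a pair `(p, m)` with `m < (T p).length`. -/
def IsProcSeq {n : ℕ} (T : Fin n → List (Fin n × ℤ))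
    (S : List (Fin n × ℕ)) : Prop :=
  S.Nodup ∧ ∀ e ∈ S, e.2 < (T e.1).length

/-- FIFO condition: whenever the event `(p, m)` occurs at some position of
`S`, every event `(p, m')` with `m' < m` occurs at an earlier position. -/
def FIFO {n : ℕ} (S : List (Fin n × ℕ)) : Prop :=
  ∀ (z : ℕ) (hz : z < S.length) (m' : ℕ), m' < (S[z]'hz).2 →
    ∃ (z' : ℕ) (hz' : z' < S.length), z' < z ∧ (S[z']'hz') = ((S[z]'hz).1, m')

/-- Balance condition: whenever an event occurs at position `z` of `S`, the
amount of its induced transfer is at most the sender's account computed from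
the induced transfer list of the first `z` entries of `S`. -/
def Balance {n : ℕ} (init : Fin n → ℤ) (T : Fin n → List (Fin n × ℤ))
    (S : List (Fin n × ℕ)) : Prop :=
  ∀ (z : ℕ) (hz : z < S.length),
    (inducedTransfer T (S[z]'hz)).v ≤
      acc init (S[z]'hz).1 (inducedList T (S.take z))

/-- A valid processing sequence. -/
def Valid {n : ℕ} (init : Fin n → ℤ) (T : Fin n → List (Fin n × ℤ))
    (S : List (Fin n × ℕ)) : Prop :=
  IsProcSeq T S ∧ FIFO S ∧ Balance init T S

theorem plus_inducedList {n : ℕ} (T : Fin n → List (Fin n × ℤ)) (j : Fin n)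
    (L : List (Fin n × ℕ)) :
    plus j (inducedList T L) =
      (L.map fun x => if (inducedTransfer T x).r = j then (inducedTransfer T x).v else 0).sum := by
  induction L with
  | nil => rfl
  | cons a L ih =>
    simp only [plus, inducedList, List.map_cons, List.filter_cons, List.sum_cons] at ih ⊢
    split_ifs <;> simp_all

theorem minus_inducedList {n : ℕ} (T : Fin n → List (Fin n × ℤ)) (j : Fin n)
    (L : List (Fin n × ℕ)) :
    minus j (inducedList T L) =
      (L.map fun x => if x.1 = j then (inducedTransfer T x).v else 0).sum := by
  induction L with
  | nil => rfl
  | cons a L ih =>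
    have hs : (inducedTransfer T a).s = a.1 := rfl
    simp only [minus, inducedList, List.map_cons, List.filter_cons, List.sum_cons] at ih ⊢
    split_ifs <;> simp_all

theorem inducedTransfer_nonneg {n : ℕ} {T : Fin n → List (Fin n × ℤ)}
    (hT : ∀ p : Fin n, ∀ x ∈ T p, 0 ≤ x.2) (e : Fin n × ℕ) :
    0 ≤ (inducedTransfer T e).v := by
  rcases lt_or_ge e.2 (T e.1).length with h | h
  · simpa [inducedTransfer, List.getElem?_eq_getElem h] using hT e.1 _ (List.getElem_mem h)
  · simp [inducedTransfer, List.getElem?_eq_none h]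

/-- Extending a set of processed events by events of other senders does not lower an account. -/
theorem acc_inducedList_mono {n : ℕ} (init : Fin n → ℤ) {T : Fin n → List (Fin n × ℤ)}
    (hT : ∀ p : Fin n, ∀ x ∈ T p, 0 ≤ x.2) (j : Fin n) {M L : List (Fin n × ℕ)}
    (hM : M.Nodup) (hL : L.Nodup) (hML : ∀ x ∈ M, x ∈ L)
    (hj : ∀ x ∈ L, x.1 = j → x ∈ M) :
    acc init j (inducedList T M) ≤ acc init j (inducedList T L) := by
  obtain ⟨R, hR⟩ : ∃ R, L.Perm (M ++ R) :=
    ⟨L.diff M, (List.subperm_append_diff_self_of_count_le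
      (List.subperm_ext_iff.mp (hM.subperm hML))).symm⟩
  have hdisj := (List.nodup_append'.mp (hR.nodup_iff.mp hL)).2.2
  simp only [acc, plus_inducedList, minus_inducedList]
  rw [(hR.map _).sum_eq, (hR.map _).sum_eq, List.map_append, List.map_append, List.sum_append,
    List.sum_append]
  have hplus : 0 ≤ (R.map fun x =>
      if (inducedTransfer T x).r = j then (inducedTransfer T x).v else 0).sum := by
    refine List.sum_nonneg fun y hy => ?_
    obtain ⟨x, -, rfl⟩ := List.mem_map.mp hy
    split_ifs
    exacts [inducedTransfer_nonneg hT x, le_rfl]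
  have hminus : (R.map fun x => if x.1 = j then (inducedTransfer T x).v else 0).sum = 0 := by
    refine List.sum_eq_zero fun y hy => ?_
    obtain ⟨x, hx, rfl⟩ := List.mem_map.mp hy
    refine if_neg fun h => hdisj (hj x (hR.mem_iff.mpr ?_) h) hx
    exact List.mem_append_right _ hx
  linarith

/-- if event `e = (p, m)` occurs at position `z` of a valid
sequence `S`, and `S'` is a valid sequence not containing `e`, containing
every event occurring before position `z` in `S`, and whose events with
first component `p` are exactly the `(p, m')` with `m' < m`, then
`S' ++ [e]` is a valid processing sequence. -/
theorem valid_append_event (n : ℕ) (init : Fin n → ℤ)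
    (T : Fin n → List (Fin n × ℤ))
    (hinit : ∀ j, 0 ≤ init j) (hT : ∀ p : Fin n, ∀ x ∈ T p, 0 ≤ x.2)
    (S : List (Fin n × ℕ)) (hS : Valid init T S)
    (e : Fin n × ℕ) (z : ℕ) (hz : z < S.length) (he : S[z]'hz = e)
    (S' : List (Fin n × ℕ)) (hS' : Valid init T S')
    (heS' : e ∉ S')
    (hM : ∀ x ∈ S.take z, x ∈ S')
    (hp : ∀ m' : ℕ, (e.1, m') ∈ S' ↔ m' < e.2) :
    Valid init T (S' ++ [e]) := by
  obtain ⟨⟨hSnd, hSlen⟩, hSfifo, hSbal⟩ := hS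
  obtain ⟨⟨hnd, hlen⟩, hfifo, hbal⟩ := hS'
  refine ⟨⟨?_, ?_⟩, ?_, ?_⟩
  · exact hnd.append (List.nodup_singleton e) (by simpa using heS')
  · intro x hx
    rcases List.mem_append.mp hx with hx | hx
    · exact hlen x hx
    · obtain rfl := List.mem_singleton.mp hx
      exact hSlen _ (he ▸ List.getElem_mem hz)
  · intro k hk m' hm'
    rcases lt_or_ge k S'.length with h | h
    · rw [List.getElem_append_left h] at hm' ⊢
      obtain ⟨k', hk', hlt, heq⟩ := hfifo k h m' hm'
      refine ⟨k', hlt.trans hk, hlt, ?_⟩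
      rw [List.getElem_append_left hk', heq]
    · rw [List.getElem_append_right h, List.getElem_singleton] at hm' ⊢
      obtain ⟨k', hk', heq⟩ := List.mem_iff_getElem.mp ((hp m').mpr hm')
      refine ⟨k', (hk'.trans_le h).trans hk, hk'.trans_le h, ?_⟩
      rw [List.getElem_append_left hk', heq]
  · intro k hk
    rcases lt_or_ge k S'.length with h | h
    · rw [List.getElem_append_left h, List.take_append_of_le_length h.le]
      exact hbal k h
    · obtain rfl : k = S'.length := by
        simp only [List.length_append, List.length_singleton] at hk
        omega
      rw [List.getElem_append_right h, List.getElem_singleton, List.take_left]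
      have hb := hSbal z hz
      rw [he] at hb
      refine hb.trans (acc_inducedList_mono init hT e.1 (hSnd.sublist (List.take_sublist z S))
        hnd hM ?_)
      rintro ⟨q, m'⟩ hx rfl
      obtain ⟨k', hk', hlt, heq⟩ := hSfifo z hz m' (he ▸ (hp m').mp hx)
      rw [he] at heq
      exact heq ▸ List.mem_take_iff_getElem.mpr ⟨k', by omega, rfl⟩
end

section
/- Let S and S' be processing sequences (duplicate-free lists of events) that contain exactly the same set of events. Then for every process j : Fin n, the account values computed from their induced transfer lists coincide: acc(j, induced transfer list of S) = acc(j, induced transfer list of S'). In particular, two processes that process the same set of transfers in different orders agree on all account balances. -/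
theorem plus_eq_of_perm {n : ℕ} (j : Fin n) {L L' : List (Transfer n)}
    (h : L.Perm L') : plus j L = plus j L' :=
  ((h.filter _).map _).sum_eq

theorem minus_eq_of_perm {n : ℕ} (j : Fin n) {L L' : List (Transfer n)}
    (h : L.Perm L') : minus j L = minus j L' :=
  ((h.filter _).map _).sum_eq

theorem acc_eq_of_perm {n : ℕ} (init : Fin n → ℤ) (j : Fin n) {L L' : List (Transfer n)}
    (h : L.Perm L') : acc init j L = acc init j L' := by
  rw [acc, acc, plus_eq_of_perm j h, minus_eq_of_perm j h]

/-- two processing sequences containing exactly the same set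
of events yield the same account value for every process. -/
theorem acc_eq_of_same_events (n : ℕ) (init : Fin n → ℤ)
    (T : Fin n → List (Fin n × ℤ))
    (S S' : List (Fin n × ℕ))
    (hS : IsProcSeq T S) (hS' : IsProcSeq T S')
    (hsame : ∀ e : Fin n × ℕ, e ∈ S ↔ e ∈ S') :
    ∀ j : Fin n, acc init j (inducedList T S) = acc init j (inducedList T S') :=
  fun j => acc_eq_of_perm init j
    (((List.perm_ext_iff_of_nodup hS.1 hS'.1).mpr hsame).map (inducedTransfer T))
end
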